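/- Stability estimate for the full discretization dG(q)–cG(r). Let q ≥ 0 be an integer and l ∈ ℝ. There is a constant C > 0, independent of T, N, the mesh and the data, such that every U = (U₁,U₂) ∈ 𝒱_{h,q} satisfying B(U,V) = L̂(V) for all V ∈ 𝒱_{h,q} obeys ‖U_{1,N}^−‖_{h,l+1} + ‖U_{2,N}^−‖_{h,l} ≤ C ( ‖u_{h,0}‖_{h,l+1} + ‖v_{h,0}‖_{h,l} + ∫₀^T ( ‖R_h f₁(t)‖_{h,l+1} + ‖P_h f₂(t)‖_{h,l} ) dt ). -/

import Mathlib

noncomputable section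

open scoped RealInnerProductSpace BigOperators
open MeasureTheory

/-- Squared fractional-order norm `‖v‖_α² = Σ_k λ_k^α (v,φ_k)²`. -/
def hsNormSq {H : Type*} [NormedAddCommGroup H] [InnerProductSpace ℝ H]
    (φ : ℕ → H) (lam : ℕ → ℝ) (α : ℝ) (v : H) : ℝ :=
  ∑' k, lam k ^ α * ⟪v, φ k⟫ ^ 2

/-- Fractional-order norm `‖v‖_α`. -/
def hsNorm {H : Type*} [NormedAddCommGroup H] [InnerProductSpace ℝ H]
    (φ : ℕ → H) (lam : ℕ → ℝ) (α : ℝ) (v : H) : ℝ :=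
  Real.sqrt (hsNormSq φ lam α v)

/-- Membership in the fractional-order space `Ḣ^α`. -/
def MemHs {H : Type*} [NormedAddCommGroup H] [InnerProductSpace ℝ H]
    (φ : ℕ → H) (lam : ℕ → ℝ) (α : ℝ) (v : H) : Prop :=
  Summable (fun k => lam k ^ α * ⟪v, φ k⟫ ^ 2)

/-- Weighted spectral pairing `Σ_k λ_k^l (u,φ_k)(v,φ_k)`.
`aPow φ lam 1 u v = a(u,v)`, `aPow φ lam (l+1) u v = a(u, A^l v)` and
`aPow φ lam l u v = (u, A^l v)`. -/
def aPow {H : Type*} [NormedAddCommGroup H] [InnerProductSpace ℝ H]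
    (φ : ℕ → H) (lam : ℕ → ℝ) (l : ℝ) (u v : H) : ℝ :=
  ∑' k, lam k ^ l * ⟪u, φ k⟫ * ⟪v, φ k⟫

/-- The energy bilinear form `a(u,v) = Σ_k λ_k (u,φ_k)(v,φ_k)`. -/
def aForm {H : Type*} [NormedAddCommGroup H] [InnerProductSpace ℝ H]
    (φ : ℕ → H) (lam : ℕ → ℝ) (u v : H) : ℝ :=
  aPow φ lam 1 u v

/-- The operator `A`, determined by `A φ_k = λ_k φ_k`. -/
def Aop {H : Type*} [NormedAddCommGroup H] [InnerProductSpace ℝ H]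
    (φ : ℕ → H) (lam : ℕ → ℝ) (v : H) : H :=
  ∑' k, (lam k * ⟪v, φ k⟫) • φ k

/-- Value at time `s` of the polynomial of degree ≤ q (with coefficients `c n ·`)
attached to the `n`-th time subinterval. -/
def pval {H : Type*} [NormedAddCommGroup H] [InnerProductSpace ℝ H]
    (q : ℕ) (c : ℕ → ℕ → H) (n : ℕ) (s : ℝ) : H :=
  ∑ j ∈ Finset.range (q + 1), s ^ j • c n j

/-- Time derivative of `pval`. -/
def pderiv {H : Type*} [NormedAddCommGroup H] [InnerProductSpace ℝ H]
    (q : ℕ) (c : ℕ → ℕ → H) (n : ℕ) (s : ℝ) : H :=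
  ∑ j ∈ Finset.range (q + 1), ((j : ℝ) * s ^ (j - 1)) • c n j

/-- The dG bilinear form `B((u₁,u₂),(v₁,v₂))`, where the piecewise polynomials
`u₁, u₂, v₁, v₂` are described by their coefficient families `c1, c2, d1, d2`
(on the mesh `0 = tt 0 < tt 1 < ⋯ < tt N`). -/
def Bform {H : Type*} [NormedAddCommGroup H] [InnerProductSpace ℝ H]
    (φ : ℕ → H) (lam : ℕ → ℝ) (tt : ℕ → ℝ) (N q : ℕ)
    (c1 c2 d1 d2 : ℕ → ℕ → H) : ℝ :=
  (∑ n ∈ Finset.Icc 1 N, ∫ s in tt (n-1)..tt n,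
      (aForm φ lam (pderiv q c1 n s) (pval q d1 n s)
        - aForm φ lam (pval q c2 n s) (pval q d1 n s)
        + ⟪pderiv q c2 n s, pval q d2 n s⟫
        + aForm φ lam (pval q c1 n s) (pval q d2 n s)))
  + (∑ n ∈ Finset.Icc 1 (N-1),
      (aForm φ lam (pval q c1 (n+1) (tt n) - pval q c1 n (tt n)) (pval q d1 (n+1) (tt n))
        + ⟪pval q c2 (n+1) (tt n) - pval q c2 n (tt n), pval q d2 (n+1) (tt n)⟫))
  + aForm φ lam (pval q c1 1 (tt 0)) (pval q d1 1 (tt 0))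
  + ⟪pval q c2 1 (tt 0), pval q d2 1 (tt 0)⟫

/-- Supremum of `g` over the open interval `(a,b)`. -/
def supIoo (g : ℝ → ℝ) (a b : ℝ) : ℝ :=
  sSup (g '' Set.Ioo a b)

/-- Squared discrete fractional norm `‖v‖_{h,s}² = ‖A_h^{s/2} v‖²`, expressed through
an orthonormal eigenbasis `e` of `A_h` on `S_h` with eigenvalues `μ`. -/
def hNormSqh {H : Type*} [NormedAddCommGroup H] [InnerProductSpace ℝ H]
    {m : ℕ} (e : Fin m → H) (μ : Fin m → ℝ) (s : ℝ) (v : H) : ℝ :=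
  ∑ i, μ i ^ s * ⟪v, e i⟫ ^ 2

/-- Discrete fractional norm `‖v‖_{h,s}`. -/
def hNormh {H : Type*} [NormedAddCommGroup H] [InnerProductSpace ℝ H]
    {m : ℕ} (e : Fin m → H) (μ : Fin m → ℝ) (s : ℝ) (v : H) : ℝ :=
  Real.sqrt (hNormSqh e μ s v)

/-- Discrete weighted pairing: `aPowh e μ (l+1) u v = a(u, A_h^l v)` and
`aPowh e μ l u v = (u, A_h^l v)` for `u, v ∈ S_h`. -/
def aPowh {H : Type*} [NormedAddCommGroup H] [InnerProductSpace ℝ H]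
    {m : ℕ} (e : Fin m → H) (μ : Fin m → ℝ) (l : ℝ) (u v : H) : ℝ :=
  ∑ i, μ i ^ l * ⟪u, e i⟫ * ⟪v, e i⟫

/-- The polynomial `∑_{j ≤ q} s ^ j • c j` with vector coefficients. -/
def polyVal {X : Type*} [AddCommGroup X] [Module ℝ X] (q : ℕ) (c : ℕ → X) (s : ℝ) : X :=
  ∑ j ∈ Finset.range (q + 1), s ^ j • c j

/-- The derivative of `polyVal q c`. -/
def polyDeriv {X : Type*} [AddCommGroup X] [Module ℝ X] (q : ℕ) (c : ℕ → X) (s : ℝ) : X :=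
  ∑ j ∈ Finset.range (q + 1), ((j : ℝ) * s ^ (j - 1)) • c j

lemma map_polyVal {X Y : Type*} [AddCommGroup X] [Module ℝ X] [AddCommGroup Y] [Module ℝ Y]
    (L : X →ₗ[ℝ] Y) (q : ℕ) (c : ℕ → X) (s : ℝ) :
    L (polyVal q c s) = polyVal q (fun j => L (c j)) s := by
  simp [polyVal]

lemma map_polyDeriv {X Y : Type*} [AddCommGroup X] [Module ℝ X] [AddCommGroup Y] [Module ℝ Y]
    (L : X →ₗ[ℝ] Y) (q : ℕ) (c : ℕ → X) (s : ℝ) :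
    L (polyDeriv q c s) = polyDeriv q (fun j => L (c j)) s := by
  simp [polyDeriv]

/-- The Gram matrix of the monomials of degree at most `q` in `L²(0,1)`. -/
def monomialGram (q : ℕ) : Matrix (Fin (q + 1)) (Fin (q + 1)) ℝ :=
  Matrix.of fun i j => ∫ x in (0 : ℝ)..1, x ^ (i : ℕ) * x ^ (j : ℕ)

section Polynomials

variable {X : Type*} [NormedAddCommGroup X] [InnerProductSpace ℝ X]

lemma monomialGram_mulVec_eq_zero {q : ℕ} {v : Fin (q + 1) → ℝ}
    (hv : (monomialGram q).mulVec v = 0) : v = 0 := by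
  set p : Polynomial ℝ := ∑ j : Fin (q + 1), Polynomial.monomial (j : ℕ) (v j) with hp
  have heval : ∀ x, p.eval x = ∑ j : Fin (q + 1), v j * x ^ (j : ℕ) := by
    intro x
    simp [hp, Polynomial.eval_finsetSum]
  have hrow : ∀ i : Fin (q + 1), ∫ x in (0 : ℝ)..1, x ^ (i : ℕ) * p.eval x = 0 := by
    intro i
    have h := congrFun hv i
    simp only [Matrix.mulVec, dotProduct, monomialGram, Matrix.of_apply, Pi.zero_apply] at h
    rw [← h]
    simp only [heval, Finset.mul_sum]
    rw [intervalIntegral.integral_finsetSum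
      (fun j _ => Continuous.intervalIntegrable (by fun_prop) _ _)]
    refine Finset.sum_congr rfl fun j _ => ?_
    rw [← intervalIntegral.integral_mul_const]
    congr 1
    ext x
    ring
  have hsq : ∫ x in (0 : ℝ)..1, p.eval x ^ 2 = 0 := by
    have : ∀ x, p.eval x ^ 2 = ∑ i : Fin (q + 1), v i * (x ^ (i : ℕ) * p.eval x) := by
      intro x
      rw [sq]
      nth_rewrite 1 [heval]
      rw [Finset.sum_mul]
      exact Finset.sum_congr rfl fun j _ => by ring
    simp only [this]
    rw [intervalIntegral.integral_finsetSum
      (fun j _ => Continuous.intervalIntegrable (by fun_prop) _ _)]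
    simp [intervalIntegral.integral_const_mul, hrow]
  have hzero : ∀ x ∈ Set.Icc (0 : ℝ) 1, p.eval x = 0 := by
    by_contra! hne
    obtain ⟨x, hx, hx0⟩ := hne
    have := intervalIntegral.integral_pos (f := fun x => p.eval x ^ 2) one_pos
      (by fun_prop) (fun y _ => sq_nonneg _) ⟨x, hx, by positivity⟩
    exact this.ne' hsq
  have hp0 : p = 0 := by
    refine Polynomial.eq_zero_of_infinite_isRoot p ?_
    exact (Set.Icc_infinite (one_pos : (0 : ℝ) < 1)).mono fun x hx => hzero x hx
  ext i
  have : p.coeff i = v i := by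
    simp only [hp, Polynomial.finsetSum_coeff, Polynomial.coeff_monomial]
    rw [Finset.sum_eq_single i]
    · simp
    · intro j _ hj
      simp [Fin.val_inj, hj]
    · simp
  rw [← this, hp0]
  simp

lemma isUnit_det_monomialGram (q : ℕ) : IsUnit (monomialGram q).det := by
  rw [isUnit_iff_ne_zero]
  intro h
  obtain ⟨v, hv0, hv⟩ := Matrix.exists_mulVec_eq_zero_iff.mpr h
  exact hv0 (monomialGram_mulVec_eq_zero hv)

lemma continuous_polyVal (q : ℕ) (c : ℕ → X) : Continuous (polyVal q c) := by
  unfold polyVal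
  fun_prop

lemma continuous_polyDeriv (q : ℕ) (c : ℕ → X) : Continuous (polyDeriv q c) := by
  unfold polyDeriv
  fun_prop

lemma hasDerivAt_polyVal (q : ℕ) (c : ℕ → X) (s : ℝ) :
    HasDerivAt (polyVal q c) (polyDeriv q c s) s := by
  unfold polyVal polyDeriv
  exact HasDerivAt.fun_sum fun j _ => (hasDerivAt_pow j s).smul_const (c j)

/-- Vector polynomials are closed under affine substitutions. -/
lemma exists_polyVal_comp_affine (q : ℕ) (c : ℕ → X) (α β : ℝ) :
    ∃ d : ℕ → X, ∀ s, polyVal q c (α * s + β) = polyVal q d s := by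
  refine ⟨fun i => ∑ j ∈ Finset.range (q + 1),
    ((Polynomial.C α * Polynomial.X + Polynomial.C β) ^ j).coeff i • c j, fun s => ?_⟩
  unfold polyVal
  simp only [Finset.smul_sum]
  rw [Finset.sum_comm]
  refine Finset.sum_congr rfl fun j hj => ?_
  have hdeg : ((Polynomial.C α * Polynomial.X + Polynomial.C β) ^ j).natDegree < q + 1 := by
    refine lt_of_le_of_lt (Polynomial.natDegree_pow_le_of_le j
      (Polynomial.natDegree_linear_le (a := α) (b := β))) ?_
    simpa using hj
  have h := Polynomial.eval_eq_sum_range' hdeg s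
  simp only [Polynomial.eval_pow, Polynomial.eval_add, Polynomial.eval_mul, Polynomial.eval_C,
    Polynomial.eval_X] at h
  rw [h, Finset.sum_smul]
  exact Finset.sum_congr rfl fun i _ => by rw [smul_smul, mul_comm]

/-- The derivative of a vector polynomial is a vector polynomial. -/
lemma exists_polyDeriv_eq (q : ℕ) (c : ℕ → X) :
    ∃ d : ℕ → X, ∀ s, polyDeriv q c s = polyVal q d s := by
  refine ⟨fun j => if j = q then 0 else ((j + 1 : ℕ) : ℝ) • c (j + 1), fun s => ?_⟩
  unfold polyVal polyDeriv
  rw [Finset.sum_range_succ', Finset.sum_range_succ]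
  simp only [Nat.cast_zero, zero_mul, zero_smul, add_zero, if_true, smul_zero]
  refine Finset.sum_congr rfl fun j hj => ?_
  rw [if_neg (Finset.mem_range.mp hj).ne, smul_smul, Nat.add_sub_cancel, mul_comm]

lemma sum_smul_sum_smul_of_mul_eq_one {ι : Type*} [Fintype ι] [DecidableEq ι]
    {P Q : Matrix ι ι ℝ} (h : P * Q = 1) (x : ι → X) (i : ι) :
    ∑ j, P i j • ∑ k, Q j k • x k = x i := by
  simp only [Finset.smul_sum, smul_smul]
  rw [Finset.sum_comm]
  simp only [← Finset.sum_smul, ← Matrix.mul_apply, h, Matrix.one_apply]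
  simp

/-- Coefficients of the `L²(0,1)` projection onto vector polynomials of degree at most `q`. -/
def projCoeff (q : ℕ) (v : ℝ → X) (i : ℕ) : X :=
  if hi : i < q + 1 then
    ∑ j : Fin (q + 1), (monomialGram q)⁻¹ ⟨i, hi⟩ j • ∫ x in (0 : ℝ)..1, x ^ (j : ℕ) • v x
  else 0

lemma projCoeff_coe (q : ℕ) (v : ℝ → X) (i : Fin (q + 1)) :
    projCoeff q v i
      = ∑ j : Fin (q + 1), (monomialGram q)⁻¹ i j • ∫ x in (0 : ℝ)..1, x ^ (j : ℕ) • v x := by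
  rw [projCoeff, dif_pos i.isLt]

/-- Bound for the `L¹`–`L^∞` norm of the `L²(0,1)` projection. -/
def projConst (q : ℕ) : ℝ := ∑ i : Fin (q + 1), ∑ j : Fin (q + 1), |(monomialGram q)⁻¹ i j|

lemma norm_polyVal_projCoeff_le (q : ℕ) {v : ℝ → X} (hv : Continuous v) {s : ℝ}
    (hs : s ∈ Set.Icc (0 : ℝ) 1) :
    ‖polyVal q (projCoeff q v) s‖ ≤ projConst q * ∫ x in (0 : ℝ)..1, ‖v x‖ := by
  have hmom : ∀ j : ℕ, ‖∫ x in (0 : ℝ)..1, x ^ j • v x‖ ≤ ∫ x in (0 : ℝ)..1, ‖v x‖ := by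
    intro j
    refine intervalIntegral.norm_integral_le_of_norm_le zero_le_one ?_
      (hv.norm.intervalIntegrable _ _)
    refine Filter.Eventually.of_forall fun x hx => ?_
    rw [norm_smul, norm_pow, Real.norm_of_nonneg hx.1.le]
    exact mul_le_of_le_one_left (norm_nonneg _) (pow_le_one₀ hx.1.le hx.2)
  unfold polyVal projConst
  rw [Finset.sum_range, Finset.sum_mul]
  refine (norm_sum_le _ _).trans (Finset.sum_le_sum fun i _ => ?_)
  rw [norm_smul, norm_pow, Real.norm_of_nonneg hs.1, projCoeff_coe, Finset.sum_mul]
  refine (mul_le_of_le_one_left (norm_nonneg _) (pow_le_one₀ hs.1 hs.2)).trans ?_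
  refine (norm_sum_le _ _).trans (Finset.sum_le_sum fun j _ => ?_)
  rw [norm_smul, Real.norm_eq_abs]
  exact mul_le_mul_of_nonneg_left (hmom j) (abs_nonneg _)

lemma integral_inner_polyDeriv_weight (q : ℕ) (c : ℕ → X) (a b β γ : ℝ) :
    ∫ s in a..b, ⟪polyDeriv q c s, (β - γ * s) • polyVal q c s⟫
      = ((β - γ * b) * ‖polyVal q c b‖ ^ 2 - (β - γ * a) * ‖polyVal q c a‖ ^ 2
          + γ * ∫ s in a..b, ‖polyVal q c s‖ ^ 2) / 2 := by
  have hp := continuous_polyVal q c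
  have hp' := continuous_polyDeriv q c
  have hderiv : ∀ s, HasDerivAt (fun s => (β - γ * s) * ‖polyVal q c s‖ ^ 2)
      (2 * ⟪polyDeriv q c s, (β - γ * s) • polyVal q c s⟫ - γ * ‖polyVal q c s‖ ^ 2) s := by
    intro s
    have h1 : HasDerivAt (fun s => β - γ * s) (-γ) s := by
      simpa using ((hasDerivAt_id s).const_mul γ).const_sub β
    refine (h1.mul (hasDerivAt_polyVal q c s).norm_sq).congr_deriv ?_
    rw [real_inner_smul_right, real_inner_comm (polyVal q c s)]
    ring
  have hI := intervalIntegral.integral_eq_sub_of_hasDerivAt (a := a) (b := b)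
    (fun s _ => hderiv s) (Continuous.intervalIntegrable (by fun_prop) _ _)
  rw [intervalIntegral.integral_sub (Continuous.intervalIntegrable (by fun_prop) _ _)
    (Continuous.intervalIntegrable (by fun_prop) _ _),
    intervalIntegral.integral_const_mul, intervalIntegral.integral_const_mul] at hI
  linarith

lemma integral_inner_le_mul_integral_norm {a b : ℝ} (hab : a ≤ b) {g v : ℝ → X} {S : ℝ}
    (hg : IntervalIntegrable g volume a b) (hS : ∀ s ∈ Set.Icc a b, ‖v s‖ ≤ S) :
    |∫ s in a..b, ⟪g s, v s⟫| ≤ S * ∫ s in a..b, ‖g s‖ := by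
  rw [← intervalIntegral.integral_const_mul, ← Real.norm_eq_abs]
  refine intervalIntegral.norm_integral_le_of_norm_le hab
    (Filter.Eventually.of_forall fun s hs => ?_) (hg.norm.const_mul S)
  refine (norm_inner_le_norm _ _).trans ?_
  rw [mul_comm]
  exact mul_le_mul_of_nonneg_right (hS s ⟨hs.1.le, hs.2⟩) (norm_nonneg _)

variable [CompleteSpace X]

lemma integral_inner_polyVal_left (q : ℕ) (d : ℕ → X) {v : ℝ → X} (hv : Continuous v) :
    ∫ x in (0 : ℝ)..1, ⟪polyVal q d x, v x⟫
      = ∑ j ∈ Finset.range (q + 1), ⟪d j, ∫ x in (0 : ℝ)..1, x ^ j • v x⟫ := by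
  have h : ∀ x, ⟪polyVal q d x, v x⟫
      = ∑ j ∈ Finset.range (q + 1), ⟪d j, x ^ j • v x⟫ := by
    intro x
    simp only [polyVal, sum_inner, real_inner_smul_left, real_inner_smul_right]
  simp only [h]
  rw [intervalIntegral.integral_finsetSum
    (fun j _ => Continuous.intervalIntegrable (by fun_prop) _ _)]
  refine Finset.sum_congr rfl fun j _ => ?_
  exact (innerSL ℝ (d j)).intervalIntegral_comp_comm
    (Continuous.intervalIntegrable (by fun_prop) _ _)

lemma integral_pow_smul_polyVal (q : ℕ) (c : ℕ → X) (i : Fin (q + 1)) :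
    ∫ x in (0 : ℝ)..1, x ^ (i : ℕ) • polyVal q c x
      = ∑ j : Fin (q + 1), monomialGram q i j • c j := by
  simp only [polyVal, Finset.smul_sum, smul_smul, Finset.sum_range]
  rw [intervalIntegral.integral_finsetSum
    (fun j _ => Continuous.intervalIntegrable (by fun_prop) _ _)]
  refine Finset.sum_congr rfl fun j _ => ?_
  rw [intervalIntegral.integral_smul_const]
  rfl

lemma polyVal_projCoeff_polyVal (q : ℕ) (c : ℕ → X) (s : ℝ) :
    polyVal q (projCoeff q (polyVal q c)) s = polyVal q c s := by
  unfold polyVal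
  rw [Finset.sum_range, Finset.sum_range]
  refine Finset.sum_congr rfl fun i _ => ?_
  congr 1
  rw [projCoeff_coe]
  have h := sum_smul_sum_smul_of_mul_eq_one
    (Matrix.nonsing_inv_mul _ (isUnit_det_monomialGram q)) (fun j : Fin (q + 1) => c j) i
  rw [← h]
  exact Finset.sum_congr rfl fun j _ => by rw [← integral_pow_smul_polyVal]; rfl

lemma integral_inner_polyVal_projCoeff (q : ℕ) (d : ℕ → X) {v : ℝ → X} (hv : Continuous v) :
    ∫ x in (0 : ℝ)..1, ⟪polyVal q d x, polyVal q (projCoeff q v) x⟫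
      = ∫ x in (0 : ℝ)..1, ⟪polyVal q d x, v x⟫ := by
  rw [integral_inner_polyVal_left q d hv,
    integral_inner_polyVal_left q d (continuous_polyVal q _), Finset.sum_range, Finset.sum_range]
  refine Finset.sum_congr rfl fun i _ => ?_
  congr 1
  rw [integral_pow_smul_polyVal]
  simp only [projCoeff_coe]
  exact sum_smul_sum_smul_of_mul_eq_one (Matrix.mul_nonsing_inv _ (isUnit_det_monomialGram q))
    (fun j : Fin (q + 1) => ∫ x in (0 : ℝ)..1, x ^ (j : ℕ) • v x) i

lemma projConst_nonneg (q : ℕ) : 0 ≤ projConst q :=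
  Finset.sum_nonneg fun _ _ => Finset.sum_nonneg fun _ _ => abs_nonneg _

lemma integral_eq_mul_integral_unit {a b : ℝ} (hab : a < b) (f : ℝ → ℝ) :
    ∫ s in a..b, f s = (b - a) * ∫ x in (0 : ℝ)..1, f ((b - a) * x + a) := by
  have hk : b - a ≠ 0 := (sub_pos.mpr hab).ne'
  rw [intervalIntegral.integral_comp_mul_add f hk]
  simp [hk]

/-- The `L²(a,b)` projection onto vector polynomials of degree at most `q`, with its
`L¹`–`L^∞` bound. -/
lemma exists_polyVal_projection (q : ℕ) {a b : ℝ} (hab : a < b) {v : ℝ → X}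
    (hv : Continuous v) :
    ∃ w : ℕ → X,
      (∀ d : ℕ → X, ∫ s in a..b, ⟪polyVal q d s, polyVal q w s⟫
        = ∫ s in a..b, ⟪polyVal q d s, v s⟫) ∧
      ∀ s ∈ Set.Icc a b,
        (b - a) * ‖polyVal q w s‖ ≤ projConst q * ∫ s in a..b, ‖v s‖ := by
  have hk : 0 < b - a := sub_pos.mpr hab
  have hv' : Continuous fun x => v ((b - a) * x + a) := by fun_prop
  obtain ⟨w, hw⟩ := exists_polyVal_comp_affine q
    (projCoeff q fun x => v ((b - a) * x + a)) (b - a)⁻¹ (-((b - a)⁻¹ * a))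
  have hw' : ∀ x, polyVal q w ((b - a) * x + a)
      = polyVal q (projCoeff q fun x => v ((b - a) * x + a)) x := by
    intro x
    rw [← hw]
    congr 1
    field_simp
    ring
  refine ⟨w, fun d => ?_, fun s hs => ?_⟩
  · obtain ⟨d', hd'⟩ := exists_polyVal_comp_affine q d (b - a) a
    rw [integral_eq_mul_integral_unit hab, integral_eq_mul_integral_unit hab]
    simp only [hw', hd']
    rw [integral_inner_polyVal_projCoeff q d' hv']
  · rw [integral_eq_mul_integral_unit hab fun s => ‖v s‖, ← hw, mul_left_comm]
    refine mul_le_mul_of_nonneg_left (norm_polyVal_projCoeff_le q hv' ⟨?_, ?_⟩) hk.le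
    · have : (b - a)⁻¹ * s + -((b - a)⁻¹ * a) = (s - a) / (b - a) := by field_simp; ring
      rw [this]
      exact div_nonneg (by linarith [hs.1]) hk.le
    · have : (b - a)⁻¹ * s + -((b - a)⁻¹ * a) = (s - a) / (b - a) := by field_simp; ring
      rw [this, div_le_one hk]
      linarith [hs.2]

/-- Inverse inequality between the maximum norm and the `L¹` norm of vector polynomials. -/
lemma norm_polyVal_le_integral (q : ℕ) {a b : ℝ} (hab : a < b) (c : ℕ → X) {s : ℝ}
    (hs : s ∈ Set.Icc a b) :
    (b - a) * ‖polyVal q c s‖ ≤ projConst q * ∫ s in a..b, ‖polyVal q c s‖ := by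
  have hk : 0 < b - a := sub_pos.mpr hab
  obtain ⟨d, hd⟩ := exists_polyVal_comp_affine q c (b - a) a
  have hs' : s = (b - a) * ((s - a) / (b - a)) + a := by field_simp; ring
  rw [integral_eq_mul_integral_unit hab fun s => ‖polyVal q c s‖, hs']
  simp only [hd]
  rw [mul_left_comm, ← polyVal_projCoeff_polyVal]
  refine mul_le_mul_of_nonneg_left
    (norm_polyVal_projCoeff_le q (continuous_polyVal q d) ⟨?_, ?_⟩) hk.le
  · exact div_nonneg (by linarith [hs.1]) hk.le
  · rw [div_le_one hk]
    linarith [hs.2]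

lemma sq_integral_le_mul_integral_sq {a b : ℝ} (hab : a < b) {f : ℝ → ℝ} (hf : Continuous f) :
    (∫ s in a..b, f s) ^ 2 ≤ (b - a) * ∫ s in a..b, f s ^ 2 := by
  have hk : 0 < b - a := sub_pos.mpr hab
  set I := ∫ s in a..b, f s with hI
  have h : 0 ≤ ∫ s in a..b, ((b - a) * f s - I) ^ 2 :=
    intervalIntegral.integral_nonneg hab.le fun s _ => sq_nonneg _
  have hexp : ∀ s, ((b - a) * f s - I) ^ 2
      = (b - a) ^ 2 * f s ^ 2 - 2 * (b - a) * I * f s + I ^ 2 := fun s => by ring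
  simp only [hexp] at h
  rw [intervalIntegral.integral_add (Continuous.intervalIntegrable (by fun_prop) _ _)
      (Continuous.intervalIntegrable (by fun_prop) _ _),
    intervalIntegral.integral_sub (Continuous.intervalIntegrable (by fun_prop) _ _)
      (Continuous.intervalIntegrable (by fun_prop) _ _),
    intervalIntegral.integral_const_mul, intervalIntegral.integral_const_mul, ← hI,
    intervalIntegral.integral_const, smul_eq_mul] at h
  have : 0 ≤ (b - a) * ((b - a) * (∫ s in a..b, f s ^ 2) - I ^ 2) := by linarith
  linarith [nonneg_of_mul_nonneg_right this hk]

end Polynomials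

lemma le_add_mul_of_energy_bounds {B x y J F S c D : ℝ} (hc : c = 4 * B ^ 2 + 8 * B ^ 4)
    (hD : D = 4 * c + 2) (hx : 0 ≤ x) (hF : 0 ≤ F)
    (henergy : y ^ 2 + J ^ 2 ≤ x ^ 2 + 2 * (S * F))
    (hS : S ^ 2 ≤ B ^ 2 * ((x + J) ^ 2 + 2 * (J + F) * S)) :
    y ≤ x + 2 * D * F := by
  have hc0 : 0 ≤ c := by rw [hc]; positivity
  have hD0 : 0 ≤ D := by rw [hD]; positivity
  have h1 : S ^ 2 ≤ c * (x ^ 2 + J ^ 2 + F ^ 2) := by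
    have hx2 : B ^ 2 * (x + J) ^ 2 ≤ B ^ 2 * (2 * x ^ 2 + 2 * J ^ 2) :=
      mul_le_mul_of_nonneg_left (by nlinarith [sq_nonneg (x - J)]) (sq_nonneg B)
    have hJF : B ^ 4 * (J + F) ^ 2 ≤ B ^ 4 * (2 * J ^ 2 + 2 * F ^ 2) :=
      mul_le_mul_of_nonneg_left (by nlinarith [sq_nonneg (J - F)]) (by positivity)
    have hyoung := sq_nonneg (S - 2 * B ^ 2 * (J + F))
    have hBx : 0 ≤ B ^ 4 * x ^ 2 := by positivity
    have hBF : 0 ≤ B ^ 2 * F ^ 2 := by positivity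
    rw [hc]
    linarith
  have h2 : S ^ 2 ≤ c * (2 * x ^ 2 + 2 * (S * F) + F ^ 2) :=
    h1.trans (mul_le_mul_of_nonneg_left (by linarith [sq_nonneg y]) hc0)
  have h3 : S ^ 2 ≤ (D * (x + F)) ^ 2 := by
    have hyoung := sq_nonneg (S - 2 * c * F)
    have e1 : 0 ≤ D ^ 2 * (x * F) := by positivity
    have e2 : D ^ 2 = 16 * c ^ 2 + 16 * c + 4 := by rw [hD]; ring
    have e3 : 0 ≤ c ^ 2 * x ^ 2 := by positivity
    have e4 : 0 ≤ c * x ^ 2 := by positivity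
    have e5 : 0 ≤ c ^ 2 * F ^ 2 := by positivity
    have e6 : 0 ≤ c * F ^ 2 := by positivity
    have e7 : (D * (x + F)) ^ 2
        = (16 * c ^ 2 + 16 * c + 4) * (x ^ 2 + F ^ 2) + 2 * (D ^ 2 * (x * F)) := by
      rw [← e2]; ring
    rw [e7]
    linarith [sq_nonneg x, sq_nonneg F]
  have h4 : S ≤ D * (x + F) := le_of_sq_le_sq h3 (by positivity)
  have h5 : S * F ≤ D * (x + F) * F := mul_le_mul_of_nonneg_right h4 hF
  refine le_of_sq_le_sq ?_ (by positivity)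
  have e1 : 0 ≤ D * (x * F) := by positivity
  have e2 : 0 ≤ (D - 1) * (D * F ^ 2) := by
    have : 0 ≤ D - 1 := by rw [hD]; linarith
    positivity
  nlinarith [sq_nonneg J, mul_nonneg hD0 (sq_nonneg F)]

/-- The constant of the one-step stability estimate of the dG(`q`) method. -/
def stepConst (q : ℕ) : ℝ :=
  2 * (4 * (4 * projConst q ^ 2 + 8 * projConst q ^ 4) + 2)

lemma stepConst_nonneg (q : ℕ) : 0 ≤ stepConst q := by
  unfold stepConst
  positivity

/-- One-step stability of the dG(`q`) method for `ẋ = K x + g` with skew `K`. -/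
lemma norm_polyVal_right_le_of_dG {X : Type*} [NormedAddCommGroup X] [InnerProductSpace ℝ X]
    [CompleteSpace X] (q : ℕ) {a b : ℝ} (hab : a < b) (K : X →ₗ[ℝ] X)
    (hK : ∀ x, ⟪K x, x⟫ = 0) (c : ℕ → X) (x₀ : X) {g : ℝ → X}
    (hg : IntervalIntegrable g volume a b)
    (h : ∀ d : ℕ → X,
      (∫ s in a..b, (⟪polyDeriv q c s, polyVal q d s⟫ - ⟪K (polyVal q c s), polyVal q d s⟫))
        + ⟪polyVal q c a - x₀, polyVal q d a⟫
      = ∫ s in a..b, ⟪g s, polyVal q d s⟫) :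
    ‖polyVal q c b‖ ≤ ‖x₀‖ + stepConst q * ∫ s in a..b, ‖g s‖ := by
  have hk : 0 < b - a := sub_pos.mpr hab
  have hp := continuous_polyVal q c
  have hKp : ∀ s, K (polyVal q c s) = polyVal q (fun j => K (c j)) s :=
    map_polyVal K q c
  have hKc : Continuous fun s => K (polyVal q c s) := by
    simp only [hKp]
    exact continuous_polyVal q _
  have hp' := continuous_polyDeriv q c
  set B := projConst q
  set F := ∫ s in a..b, ‖g s‖ with hF
  set I := ∫ s in a..b, ‖polyVal q c s‖ with hI
  set Q := ∫ s in a..b, ‖polyVal q c s‖ ^ 2 with hQ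
  set S := B * I / (b - a) with hS
  set J := ‖polyVal q c a - x₀‖ with hJ
  have hF0 : 0 ≤ F := intervalIntegral.integral_nonneg hab.le fun s _ => norm_nonneg _
  have hI0 : 0 ≤ I := intervalIntegral.integral_nonneg hab.le fun s _ => norm_nonneg _
  have hB0 : 0 ≤ B := projConst_nonneg q
  have hkS : (b - a) * S = B * I := by rw [hS]; field_simp
  have hpS : ∀ s ∈ Set.Icc a b, ‖polyVal q c s‖ ≤ S := fun s hs => by
    rw [hS, le_div_iff₀ hk, mul_comm]
    exact norm_polyVal_le_integral q hab c hs
  have henergy : ‖polyVal q c b‖ ^ 2 + J ^ 2 ≤ ‖x₀‖ ^ 2 + 2 * (S * F) := by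
    have h1 := h c
    have h2 := integral_inner_polyDeriv_weight q c a b 1 0
    simp only [zero_mul, sub_zero, one_smul, one_mul, add_zero] at h2
    simp only [hK, sub_zero, h2] at h1
    have h3 := (abs_le.mp (integral_inner_le_mul_integral_norm hab.le hg hpS)).2
    rw [← h1] at h3
    have h4 : ‖x₀‖ ^ 2 = ‖polyVal q c a - (polyVal q c a - x₀)‖ ^ 2 := by congr 2; abel
    rw [norm_sub_sq_real, real_inner_comm] at h4
    linarith
  have hweight : Q ≤ (b - a) * (‖polyVal q c a‖ ^ 2 + 2 * (J + F) * S) := by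
    have hv : Continuous fun s => (b - 1 * s) • polyVal q c s := by fun_prop
    obtain ⟨w, hw, hwb⟩ := exists_polyVal_projection q hab hv
    have hθ : ∫ s in a..b, ‖(b - 1 * s) • polyVal q c s‖ ≤ (b - a) * I := by
      rw [hI, ← intervalIntegral.integral_const_mul]
      refine intervalIntegral.integral_mono_on hab.le (hv.norm.intervalIntegrable _ _)
        (Continuous.intervalIntegrable (by fun_prop) _ _) fun s hs => ?_
      rw [norm_smul, Real.norm_of_nonneg (by linarith [hs.2])]
      exact mul_le_mul_of_nonneg_right (by linarith [hs.1]) (norm_nonneg _)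
    have hwS : ∀ s ∈ Set.Icc a b, ‖polyVal q w s‖ ≤ (b - a) * S := fun s hs => by
      have := (hwb s hs).trans (mul_le_mul_of_nonneg_left hθ hB0)
      rw [hkS]
      exact le_of_mul_le_mul_left (by linarith) hk
    have h1 := h w
    obtain ⟨d, hd⟩ := exists_polyDeriv_eq q c
    have h2 : ∫ s in a..b, (⟪polyDeriv q c s, polyVal q w s⟫
        - ⟪K (polyVal q c s), polyVal q w s⟫) = (Q - (b - a) * ‖polyVal q c a‖ ^ 2) / 2 := by
      have hwc := continuous_polyVal q w
      rw [intervalIntegral.integral_sub ((hp'.inner hwc).intervalIntegrable _ _)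
        ((hKc.inner hwc).intervalIntegrable _ _)]
      simp only [hd, hKp, hw]
      simp only [← hd, ← hKp]
      rw [integral_inner_polyDeriv_weight]
      simp only [real_inner_smul_right, hK]
      simp only [mul_zero, intervalIntegral.integral_zero, ← hQ]
      ring
    rw [h2] at h1
    have h3 := (abs_le.mp (integral_inner_le_mul_integral_norm hab.le hg hwS)).2
    have h4 : -(J * ((b - a) * S)) ≤ ⟪polyVal q c a - x₀, polyVal q w a⟫ := by
      refine neg_le_of_abs_le ((abs_real_inner_le_norm _ _).trans ?_)
      exact mul_le_mul_of_nonneg_left (hwS a (Set.left_mem_Icc.mpr hab.le)) (norm_nonneg _)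
    rw [← h1, ← hF] at h3
    linarith
  have hS2 : S ^ 2 ≤ B ^ 2 * ((‖x₀‖ + J) ^ 2 + 2 * (J + F) * S) := by
    have h1 : I ^ 2 ≤ (b - a) * Q := sq_integral_le_mul_integral_sq hab hp.norm
    have h2 : ‖polyVal q c a‖ ^ 2 ≤ (‖x₀‖ + J) ^ 2 := by
      refine pow_le_pow_left₀ (norm_nonneg _) ?_ 2
      simpa using norm_add_le x₀ (polyVal q c a - x₀)
    have h3 : (b - a) ^ 2 * S ^ 2
        ≤ (b - a) ^ 2 * (B ^ 2 * ((‖x₀‖ + J) ^ 2 + 2 * (J + F) * S)) :=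
      calc (b - a) ^ 2 * S ^ 2 = B ^ 2 * I ^ 2 := by rw [← mul_pow, hkS, mul_pow]
        _ ≤ B ^ 2 * ((b - a) * ((b - a) * ((‖x₀‖ + J) ^ 2 + 2 * (J + F) * S))) := by
            refine mul_le_mul_of_nonneg_left (h1.trans ?_) (sq_nonneg B)
            refine mul_le_mul_of_nonneg_left (hweight.trans ?_) hk.le
            exact mul_le_mul_of_nonneg_left (by linarith) hk.le
        _ = _ := by ring
    exact le_of_mul_le_mul_left h3 (by positivity)
  exact le_add_mul_of_energy_bounds rfl rfl (norm_nonneg _) hF0 henergy hS2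

section EnergyForm

variable {H : Type*} [NormedAddCommGroup H] [InnerProductSpace ℝ H]
  {φ : ℕ → H} {lam : ℕ → ℝ} {u u' v : H}

lemma aForm_comm (u v : H) : aForm φ lam u v = aForm φ lam v u :=
  tsum_congr fun k => by ring

lemma aForm_zero_right (u : H) : aForm φ lam u 0 = 0 := by
  simp [aForm, aPow]

lemma MemHs.summable_mul (hlam : ∀ k, 0 < lam k) (hu : MemHs φ lam 1 u) (hv : MemHs φ lam 1 v) :
    Summable fun k => lam k ^ (1 : ℝ) * ⟪u, φ k⟫ * ⟪v, φ k⟫ := by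
  refine Summable.of_norm_bounded (Summable.add hu hv) fun k => ?_
  have hk : 0 ≤ lam k ^ (1 : ℝ) := Real.rpow_nonneg (hlam k).le _
  rw [mul_assoc, norm_mul, Real.norm_of_nonneg hk, ← mul_add, norm_mul, Real.norm_eq_abs,
    Real.norm_eq_abs]
  refine mul_le_mul_of_nonneg_left ?_ hk
  rw [← sq_abs ⟪u, φ k⟫, ← sq_abs ⟪v, φ k⟫]
  nlinarith [sq_nonneg (|⟪u, φ k⟫| - |⟪v, φ k⟫|), sq_nonneg |⟪u, φ k⟫|, sq_nonneg |⟪v, φ k⟫|]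

lemma aForm_sub_left (hlam : ∀ k, 0 < lam k) (hu : MemHs φ lam 1 u) (hu' : MemHs φ lam 1 u')
    (hv : MemHs φ lam 1 v) :
    aForm φ lam (u - u') v = aForm φ lam u v - aForm φ lam u' v := by
  unfold aForm aPow
  rw [← (hu.summable_mul hlam hv).tsum_sub (hu'.summable_mul hlam hv)]
  exact tsum_congr fun k => by rw [inner_sub_left]; ring

lemma aForm_sum_smul_right {ι : Type*} [Fintype ι] (hlam : ∀ k, 0 < lam k)
    (hu : MemHs φ lam 1 u) {w : ι → H} (hw : ∀ i, MemHs φ lam 1 (w i)) (r : ι → ℝ) :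
    aForm φ lam u (∑ i, r i • w i) = ∑ i, r i * aForm φ lam u (w i) := by
  unfold aForm aPow
  simp only [← tsum_mul_left]
  rw [← Summable.tsum_finsetSum fun i _ => (hu.summable_mul hlam (hw i)).mul_left (r i)]
  refine tsum_congr fun k => ?_
  rw [sum_inner, Finset.mul_sum]
  exact Finset.sum_congr rfl fun i _ => by rw [real_inner_smul_left]; ring

/-- Cauchy–Schwarz inequality for the energy form. -/
lemma abs_aForm_le (hlam : ∀ k, 0 < lam k) (hu : MemHs φ lam 1 u) (hv : MemHs φ lam 1 v) :
    |aForm φ lam u v| ≤ hsNorm φ lam 1 u * hsNorm φ lam 1 v := by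
  have hk : ∀ k, 0 ≤ lam k ^ (1 : ℝ) := fun k => Real.rpow_nonneg (hlam k).le _
  have hsum := (hu.summable_mul hlam hv).hasSum.tendsto_sum_nat
  unfold hsNorm hsNormSq
  rw [← Real.sqrt_mul (tsum_nonneg fun k => mul_nonneg (hk k) (sq_nonneg _))]
  refine Real.abs_le_sqrt (le_of_tendsto (hsum.pow 2) (Filter.Eventually.of_forall fun n => ?_))
  have hcs := Finset.sum_mul_sq_le_sq_mul_sq (Finset.range n)
    (fun k => √(lam k ^ (1 : ℝ)) * ⟪u, φ k⟫) (fun k => √(lam k ^ (1 : ℝ)) * ⟪v, φ k⟫)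
  have h1 : ∀ k, √(lam k ^ (1 : ℝ)) * ⟪u, φ k⟫ * (√(lam k ^ (1 : ℝ)) * ⟪v, φ k⟫)
      = lam k ^ (1 : ℝ) * ⟪u, φ k⟫ * ⟪v, φ k⟫ := fun k => by
    linear_combination ⟪u, φ k⟫ * ⟪v, φ k⟫ * Real.mul_self_sqrt (hk k)
  simp only [h1, mul_pow, Real.sq_sqrt (hk _)] at hcs
  refine hcs.trans (mul_le_mul ?_ ?_ ?_ ?_)
  · exact hu.sum_le_tsum _ fun k _ => mul_nonneg (hk k) (sq_nonneg _)
  · exact hv.sum_le_tsum _ fun k _ => mul_nonneg (hk k) (sq_nonneg _)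
  · exact Finset.sum_nonneg fun k _ => mul_nonneg (hk k) (sq_nonneg _)
  · exact tsum_nonneg fun k => mul_nonneg (hk k) (sq_nonneg _)

lemma intervalIntegrable_aForm_left (hlam : ∀ k, 0 < lam k) {f : ℝ → H} {a b : ℝ}
    (hmeas : AEStronglyMeasurable f volume) (hf : ∀ t, MemHs φ lam 1 (f t))
    (hint : IntervalIntegrable (fun t => hsNorm φ lam 1 (f t)) volume a b)
    (hv : MemHs φ lam 1 v) :
    IntervalIntegrable (fun t => aForm φ lam (f t) v) volume a b := by
  have hm : AEStronglyMeasurable (fun t => aForm φ lam (f t) v) volume := by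
    refine aestronglyMeasurable_of_tendsto_ae Filter.atTop
      (f := fun n t => ∑ k ∈ Finset.range n, lam k ^ (1 : ℝ) * ⟪f t, φ k⟫ * ⟪v, φ k⟫)
      (fun n => ?_) (Filter.Eventually.of_forall fun t =>
        ((hf t).summable_mul hlam hv).hasSum.tendsto_sum_nat)
    refine Finset.aestronglyMeasurable_fun_sum _ fun k _ => ?_
    exact ((hmeas.inner aestronglyMeasurable_const).const_mul _).mul_const _
  refine (hint.mul_const (hsNorm φ lam 1 v)).mono_fun' hm.restrict
    (Filter.Eventually.of_forall fun t => ?_)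
  exact abs_aForm_le hlam (hf t) hv

end EnergyForm

section Modes

variable {H : Type*} [NormedAddCommGroup H] [InnerProductSpace ℝ H] {m : ℕ}

/-- Coordinates of a pair in the eigenbasis `e`, weighted so that the Euclidean norm is the
discrete energy norm of order `l`. -/
def modeMap (e : Fin m → H) (μ : Fin m → ℝ) (l : ℝ) :
    H × H →ₗ[ℝ] EuclideanSpace ℝ (Fin m ⊕ Fin m) where
  toFun p := WithLp.toLp 2 (Sum.elim (fun i => μ i ^ ((l + 1) / 2) * ⟪p.1, e i⟫)
    (fun i => μ i ^ (l / 2) * ⟪p.2, e i⟫))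
  map_add' p r := by
    ext (i | i) <;> simp [inner_add_left, mul_add]
  map_smul' c p := by
    ext (i | i) <;> simp [real_inner_smul_left] <;> ring

/-- The first component of the test function attached to a vector of modes. -/
def testFst (e : Fin m → H) (μ : Fin m → ℝ) (l : ℝ) :
    EuclideanSpace ℝ (Fin m ⊕ Fin m) →ₗ[ℝ] H where
  toFun x := ∑ i, (μ i ^ ((l - 1) / 2) * x (Sum.inl i)) • e i
  map_add' x y := by simp [mul_add, add_smul, Finset.sum_add_distrib]
  map_smul' c x := by simp [Finset.smul_sum, smul_smul, mul_left_comm]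

/-- The second component of the test function attached to a vector of modes. -/
def testSnd (e : Fin m → H) (μ : Fin m → ℝ) (l : ℝ) :
    EuclideanSpace ℝ (Fin m ⊕ Fin m) →ₗ[ℝ] H where
  toFun x := ∑ i, (μ i ^ (l / 2) * x (Sum.inr i)) • e i
  map_add' x y := by simp [mul_add, add_smul, Finset.sum_add_distrib]
  map_smul' c x := by simp [Finset.smul_sum, smul_smul, mul_left_comm]

/-- The skew generator of the wave equation in the mode coordinates. -/
def waveGen (μ : Fin m → ℝ) :
    EuclideanSpace ℝ (Fin m ⊕ Fin m) →ₗ[ℝ] EuclideanSpace ℝ (Fin m ⊕ Fin m) where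
  toFun x := WithLp.toLp 2 (Sum.elim (fun i => μ i ^ (1 / 2 : ℝ) * x (Sum.inr i))
    (fun i => -(μ i ^ (1 / 2 : ℝ) * x (Sum.inl i))))
  map_add' x y := by
    ext (i | i) <;> simp [mul_add, add_comm]
  map_smul' c x := by
    ext (i | i) <;> simp [mul_left_comm]

lemma inner_waveGen_self (μ : Fin m → ℝ) (x : EuclideanSpace ℝ (Fin m ⊕ Fin m)) :
    ⟪waveGen μ x, x⟫ = 0 := by
  simp only [PiLp.inner_apply, Fintype.sum_sum_type, waveGen, LinearMap.coe_mk, AddHom.coe_mk,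
    Sum.elim_inl, Sum.elim_inr, RCLike.inner_apply, conj_trivial, ← Finset.sum_add_distrib]
  exact Finset.sum_eq_zero fun i _ => by ring

lemma norm_sq_modeMap {e : Fin m → H} {μ : Fin m → ℝ} (hμ : ∀ i, 0 < μ i) (l : ℝ) (p : H × H) :
    ‖modeMap e μ l p‖ ^ 2 = hNormSqh e μ (l + 1) p.1 + hNormSqh e μ l p.2 := by
  have h : ∀ (s : ℝ) (i : Fin m) (r : ℝ), (μ i ^ (s / 2) * r) ^ 2 = μ i ^ s * r ^ 2 := by
    intro s i r
    rw [mul_pow, ← Real.rpow_natCast, ← Real.rpow_mul (hμ i).le]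
    congr 2
    push_cast
    ring
  simp [EuclideanSpace.norm_sq_eq, modeMap, hNormSqh, h, -mul_eq_mul_left_iff]

lemma norm_modeMap_fst {e : Fin m → H} {μ : Fin m → ℝ} (hμ : ∀ i, 0 < μ i) (l : ℝ) (u : H) :
    ‖modeMap e μ l (u, 0)‖ = hNormh e μ (l + 1) u := by
  rw [hNormh, ← Real.sqrt_sq (norm_nonneg (modeMap e μ l (u, 0))), norm_sq_modeMap hμ]
  simp [hNormSqh]

lemma norm_modeMap_snd {e : Fin m → H} {μ : Fin m → ℝ} (hμ : ∀ i, 0 < μ i) (l : ℝ) (v : H) :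
    ‖modeMap e μ l (0, v)‖ = hNormh e μ l v := by
  rw [hNormh, ← Real.sqrt_sq (norm_nonneg (modeMap e μ l (0, v))), norm_sq_modeMap hμ]
  simp [hNormSqh]

lemma norm_modeMap_le {e : Fin m → H} {μ : Fin m → ℝ} (hμ : ∀ i, 0 < μ i) (l : ℝ) (u v : H) :
    ‖modeMap e μ l (u, v)‖ ≤ hNormh e μ (l + 1) u + hNormh e μ l v := by
  rw [← norm_modeMap_fst hμ, ← norm_modeMap_snd hμ]
  refine le_trans (le_of_eq ?_) (norm_add_le _ _)
  rw [← map_add]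
  simp

lemma hNormh_add_hNormh_le {e : Fin m → H} {μ : Fin m → ℝ} (hμ : ∀ i, 0 < μ i) (l : ℝ) (u v : H) :
    hNormh e μ (l + 1) u + hNormh e μ l v ≤ 2 * ‖modeMap e μ l (u, v)‖ := by
  have h := norm_sq_modeMap (e := e) hμ l (u, v)
  have hnn : ∀ (s : ℝ) (w : H), 0 ≤ hNormSqh e μ s w := fun s w =>
    Finset.sum_nonneg fun i _ => mul_nonneg (Real.rpow_nonneg (hμ i).le _) (sq_nonneg _)
  have h1 : hNormh e μ (l + 1) u ≤ ‖modeMap e μ l (u, v)‖ :=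
    (Real.sqrt_le_left (norm_nonneg _)).mpr (by linarith [hnn l v])
  have h2 : hNormh e μ l v ≤ ‖modeMap e μ l (u, v)‖ :=
    (Real.sqrt_le_left (norm_nonneg _)).mpr (by linarith [hnn (l + 1) u])
  linarith

lemma intervalIntegrable_modeMap (e : Fin m → H) (μ : Fin m → ℝ) (l : ℝ) {f g : ℝ → H} {a b : ℝ}
    (hf : ∀ i, IntervalIntegrable (fun t => ⟪f t, e i⟫) volume a b)
    (hg : ∀ i, IntervalIntegrable (fun t => ⟪g t, e i⟫) volume a b) :
    IntervalIntegrable (fun t => modeMap e μ l (f t, g t)) volume a b := by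
  have h : ∀ i, IntervalIntegrable (fun t => modeMap e μ l (f t, g t) i) volume a b := by
    rintro (i | i)
    · exact (hf i).const_mul _
    · exact (hg i).const_mul _
  exact ⟨Integrable.of_eval_piLp fun i => (h i).1, Integrable.of_eval_piLp fun i => (h i).2⟩

variable {φ : ℕ → H} {lam : ℕ → ℝ} {S : Submodule ℝ H} {e : Fin m → H} {μ : Fin m → ℝ} {u v : H}

lemma testFst_mem (he : ∀ i, e i ∈ S) (l : ℝ) (x : EuclideanSpace ℝ (Fin m ⊕ Fin m)) :
    testFst e μ l x ∈ S := by
  simp only [testFst, LinearMap.coe_mk, AddHom.coe_mk]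
  exact S.sum_mem fun i _ => S.smul_mem _ (he i)

lemma testSnd_mem (he : ∀ i, e i ∈ S) (l : ℝ) (x : EuclideanSpace ℝ (Fin m ⊕ Fin m)) :
    testSnd e μ l x ∈ S := by
  simp only [testSnd, LinearMap.coe_mk, AddHom.coe_mk]
  exact S.sum_mem fun i _ => S.smul_mem _ (he i)

lemma aForm_sum_smul_eigenvector (hlam : ∀ k, 0 < lam k) (hS : ∀ v ∈ S, MemHs φ lam 1 v)
    (he : ∀ i, e i ∈ S) (heig : ∀ i, ∀ w ∈ S, aForm φ lam (e i) w = μ i * ⟪e i, w⟫)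
    (hu : u ∈ S) (r : Fin m → ℝ) :
    aForm φ lam u (∑ i, r i • e i) = ∑ i, r i * (μ i * ⟪u, e i⟫) := by
  rw [aForm_sum_smul_right hlam (hS u hu) fun i => hS _ (he i)]
  exact Finset.sum_congr rfl fun i _ => by rw [aForm_comm, heig i u hu, real_inner_comm]

lemma aForm_testFst_add_inner_testSnd (hlam : ∀ k, 0 < lam k) (hμ : ∀ i, 0 < μ i)
    (hS : ∀ v ∈ S, MemHs φ lam 1 v) (he : ∀ i, e i ∈ S)
    (heig : ∀ i, ∀ w ∈ S, aForm φ lam (e i) w = μ i * ⟪e i, w⟫) (hu : u ∈ S) (v : H)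
    (l : ℝ) (x : EuclideanSpace ℝ (Fin m ⊕ Fin m)) :
    aForm φ lam u (testFst e μ l x) + ⟪v, testSnd e μ l x⟫ = ⟪modeMap e μ l (u, v), x⟫ := by
  simp only [testFst, testSnd, LinearMap.coe_mk, AddHom.coe_mk]
  rw [aForm_sum_smul_eigenvector hlam hS he heig hu, inner_sum]
  simp only [PiLp.inner_apply, Fintype.sum_sum_type, modeMap, LinearMap.coe_mk, AddHom.coe_mk,
    Sum.elim_inl, Sum.elim_inr, RCLike.inner_apply, conj_trivial]
  congr 1
  · refine Finset.sum_congr rfl fun i _ => ?_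
    have h : μ i ^ ((l + 1) / 2) = μ i ^ ((l - 1) / 2) * μ i := by
      rw [← Real.rpow_add_one (hμ i).ne']
      congr 1
      ring
    rw [h]
    ring
  · exact Finset.sum_congr rfl fun i _ => by rw [real_inner_smul_right]; ring

lemma aForm_testFst_sub_aForm_testSnd (hlam : ∀ k, 0 < lam k) (hμ : ∀ i, 0 < μ i)
    (hS : ∀ v ∈ S, MemHs φ lam 1 v) (he : ∀ i, e i ∈ S)
    (heig : ∀ i, ∀ w ∈ S, aForm φ lam (e i) w = μ i * ⟪e i, w⟫) (hu : u ∈ S) (hv : v ∈ S)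
    (l : ℝ) (x : EuclideanSpace ℝ (Fin m ⊕ Fin m)) :
    aForm φ lam v (testFst e μ l x) - aForm φ lam u (testSnd e μ l x)
      = ⟪waveGen μ (modeMap e μ l (u, v)), x⟫ := by
  simp only [testFst, testSnd, LinearMap.coe_mk, AddHom.coe_mk]
  rw [aForm_sum_smul_eigenvector hlam hS he heig hu, aForm_sum_smul_eigenvector hlam hS he heig hv]
  simp only [PiLp.inner_apply, Fintype.sum_sum_type, modeMap, waveGen, LinearMap.coe_mk,
    AddHom.coe_mk, Sum.elim_inl, Sum.elim_inr, RCLike.inner_apply, conj_trivial]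
  rw [sub_eq_add_neg, ← Finset.sum_neg_distrib]
  congr 1
  · refine Finset.sum_congr rfl fun i _ => ?_
    have h : μ i ^ ((l - 1) / 2) * μ i = μ i ^ (1 / 2 : ℝ) * μ i ^ (l / 2) := by
      rw [← Real.rpow_add_one (hμ i).ne', ← Real.rpow_add (hμ i)]
      congr 1
      ring
    linear_combination x (Sum.inl i) * ⟪v, e i⟫ * h
  · refine Finset.sum_congr rfl fun i _ => ?_
    have h : μ i ^ (l / 2) * μ i = μ i ^ (1 / 2 : ℝ) * μ i ^ ((l + 1) / 2) := by
      rw [← Real.rpow_add_one (hμ i).ne', ← Real.rpow_add (hμ i)]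
      congr 1
      ring
    linear_combination -(x (Sum.inr i) * ⟪u, e i⟫ * h)

end Modes

section Localization

variable {H : Type*} [NormedAddCommGroup H] [InnerProductSpace ℝ H]

/-- The left limit at the `k`-th node, with the initial value at the node `0`. -/
def nodeVal (q : ℕ) (tt : ℕ → ℝ) (c : ℕ → ℕ → H) (u₀ : H) (k : ℕ) : H :=
  if k = 0 then u₀ else pval q c k (tt k)

lemma pval_single (q k n : ℕ) (w : ℕ → H) (s : ℝ) :
    pval q (fun n' j => if n' = k then w j else 0) n s = if n = k then polyVal q w s else 0 := by
  by_cases h : n = k <;> simp [pval, polyVal, h]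

/-- The dG equations tested with functions supported on one time interval. -/
lemma dG_local_eq {φ : ℕ → H} {lam : ℕ → ℝ} (hlam : ∀ k, 0 < lam k) {q N : ℕ} {tt : ℕ → ℝ}
    {S : Submodule ℝ H} (hS : ∀ v ∈ S, MemHs φ lam 1 v) {f1 f2 : ℝ → H} {uh0 vh0 : H}
    (huh0 : uh0 ∈ S) {c1 c2 : ℕ → ℕ → H} (hc1 : ∀ n j, c1 n j ∈ S)
    (heq : ∀ d1 d2 : ℕ → ℕ → H, (∀ n j, d1 n j ∈ S) → (∀ n j, d2 n j ∈ S) →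
        Bform φ lam tt N q c1 c2 d1 d2 =
          (∑ n ∈ Finset.Icc 1 N, ∫ s in tt (n-1)..tt n,
              (aForm φ lam (f1 s) (pval q d1 n s) + ⟪f2 s, pval q d2 n s⟫))
            + aForm φ lam uh0 (pval q d1 1 (tt 0)) + ⟪vh0, pval q d2 1 (tt 0)⟫)
    {k : ℕ} (hk : k < N) {w1 w2 : ℕ → H} (hw1 : ∀ j, w1 j ∈ S) (hw2 : ∀ j, w2 j ∈ S) :
    (∫ s in tt k..tt (k + 1),
      (aForm φ lam (pderiv q c1 (k + 1) s) (polyVal q w1 s)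
        - aForm φ lam (pval q c2 (k + 1) s) (polyVal q w1 s)
        + ⟪pderiv q c2 (k + 1) s, polyVal q w2 s⟫
        + aForm φ lam (pval q c1 (k + 1) s) (polyVal q w2 s)))
      + (aForm φ lam (pval q c1 (k + 1) (tt k) - nodeVal q tt c1 uh0 k) (polyVal q w1 (tt k))
        + ⟪pval q c2 (k + 1) (tt k) - nodeVal q tt c2 vh0 k, polyVal q w2 (tt k)⟫)
    = ∫ s in tt k..tt (k + 1),
        (aForm φ lam (f1 s) (polyVal q w1 s) + ⟪f2 s, polyVal q w2 s⟫) := by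
  have h := heq (fun n j => if n = k + 1 then w1 j else 0) (fun n j => if n = k + 1 then w2 j else 0)
    (fun n j => by split_ifs; exacts [hw1 j, S.zero_mem])
    (fun n j => by split_ifs; exacts [hw2 j, S.zero_mem])
  have hkN : k + 1 ∈ Finset.Icc 1 N := by simp; omega
  unfold Bform at h
  simp only [pval_single] at h
  rw [Finset.sum_eq_single_of_mem (k + 1) hkN fun n _ hn => by simp [hn, aForm_zero_right],
    Finset.sum_eq_single_of_mem (k + 1) hkN fun n _ hn => by simp [hn, aForm_zero_right]] at h
  simp only [if_true, Nat.add_sub_cancel] at h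
  rcases Nat.eq_zero_or_pos k with rfl | hkpos
  · rw [Finset.sum_eq_zero fun n hn => by
      have : n ≠ 0 := by simp at hn; omega
      simp [this, aForm_zero_right]] at h
    have hw : polyVal q w1 (tt 0) ∈ S := S.sum_mem fun j _ => S.smul_mem _ (hw1 j)
    have hp : pval q c1 1 (tt 0) ∈ S := S.sum_mem fun j _ => S.smul_mem _ (hc1 1 j)
    simp only [zero_add, if_true, nodeVal] at h ⊢
    rw [aForm_sub_left hlam (hS _ hp) (hS _ huh0) (hS _ hw), inner_sub_left]
    linarith
  · have hk' : k ∈ Finset.Icc 1 (N - 1) := by simp; omega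
    have hk1 : ¬ (1 = k + 1) := by omega
    rw [Finset.sum_eq_single_of_mem k hk' fun n _ hn => by simp [hn, aForm_zero_right]] at h
    simp only [if_true, hk1, if_false, aForm_zero_right, inner_zero_right, add_zero] at h
    simpa [nodeVal, hkpos.ne'] using h

end Localization

/-- **Stability estimate for the full discretization dG(q)–cG(r).**
The constant `C > 0` is independent of `T`, `N`, the mesh, the space `S_h` and the data. -/
theorem dGcG_stability_estimate
    {H : Type*} [NormedAddCommGroup H] [InnerProductSpace ℝ H] [CompleteSpace H]
    (φ : ℕ → H) (lam : ℕ → ℝ)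
    (hφ : Orthonormal ℝ φ)
    (hφtotal : (Submodule.span ℝ (Set.range φ)).topologicalClosure = ⊤)
    (hlam_pos : ∀ k, 0 < lam k) (hlam_mono : Monotone lam)
    (hlam_top : Filter.Tendsto lam Filter.atTop Filter.atTop)
    (q : ℕ) (l : ℝ) :
    ∃ C : ℝ, 0 < C ∧
      ∀ (T : ℝ), 0 < T → ∀ (N : ℕ), 1 ≤ N →
      ∀ tt : ℕ → ℝ, tt 0 = 0 → tt N = T → (∀ n < N, tt n < tt (n + 1)) →
      -- the finite element space S_h ⊂ V together with an orthonormal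
      -- eigenbasis (e,μ) of A_h on S_h, and the projections R_h, P_h
      ∀ S : Submodule ℝ H, FiniteDimensional ℝ S → (∀ v ∈ S, MemHs φ lam 1 v) →
      ∀ (m : ℕ) (e : Fin m → H) (μ : Fin m → ℝ),
      Orthonormal ℝ e → (∀ i, e i ∈ S) →
      (∀ v ∈ S, v = ∑ i, ⟪v, e i⟫ • e i) →
      (∀ i, 0 < μ i) →
      (∀ i, ∀ w ∈ S, aForm φ lam (e i) w = μ i * ⟪e i, w⟫) →
      ∀ Rh Ph : H → H,
      (∀ v, Rh v ∈ S) →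
      (∀ v, MemHs φ lam 1 v → ∀ χ ∈ S, aForm φ lam (Rh v - v) χ = 0) →
      (∀ v, Ph v ∈ S) →
      (∀ v, ∀ χ ∈ S, ⟪Ph v - v, χ⟫ = 0) →
      -- the data
      ∀ f1 f2 : ℝ → H, ∀ uh0 vh0 : H, uh0 ∈ S → vh0 ∈ S →
      AEStronglyMeasurable f1 volume → AEStronglyMeasurable f2 volume →
      (∀ t, MemHs φ lam 1 (f1 t)) →
      IntervalIntegrable (fun t => hsNorm φ lam 1 (f1 t)) volume 0 T →
      IntervalIntegrable f2 volume 0 T →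
      -- U = (U₁,U₂) ∈ 𝒱_{h,q}
      ∀ c1 c2 : ℕ → ℕ → H,
      (∀ n j, c1 n j ∈ S) → (∀ n j, c2 n j ∈ S) →
      -- B(U,V) = L̂(V) for every V = (V₁,V₂) ∈ 𝒱_{h,q}
      (∀ d1 d2 : ℕ → ℕ → H, (∀ n j, d1 n j ∈ S) → (∀ n j, d2 n j ∈ S) →
        Bform φ lam tt N q c1 c2 d1 d2 =
          (∑ n ∈ Finset.Icc 1 N, ∫ s in tt (n-1)..tt n,
              (aForm φ lam (f1 s) (pval q d1 n s) + ⟪f2 s, pval q d2 n s⟫))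
            + aForm φ lam uh0 (pval q d1 1 (tt 0)) + ⟪vh0, pval q d2 1 (tt 0)⟫) →
      hNormh e μ (l+1) (pval q c1 N (tt N)) + hNormh e μ l (pval q c2 N (tt N))
        ≤ C * (hNormh e μ (l+1) uh0 + hNormh e μ l vh0
            + ∫ t in (0:ℝ)..T,
                (hNormh e μ (l+1) (Rh (f1 t)) + hNormh e μ l (Ph (f2 t)))) := by
  refine ⟨2 * (1 + stepConst q), by have := stepConst_nonneg q; positivity, ?_⟩
  intro T hT N hN tt htt0 httN httlt S _ hS m e μ he heS hbasis hμ heig Rh Ph hRhS hRh hPhS hPh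
    f1 f2 uh0 vh0 huh0 hvh0 hf1m hf2m hf1 hf1int hf2int c1 c2 hc1 hc2 heq
  have hmono : ∀ j k, j ≤ k → k ≤ N → tt j ≤ tt k := by
    intro j k hjk
    induction k, hjk using Nat.le_induction with
    | base => exact fun _ => le_rfl
    | succ k _ ih => exact fun hk => (ih (by omega)).trans (httlt k (by omega)).le
  have hf1R : ∀ t, ∀ χ ∈ S, aForm φ lam (f1 t) χ = aForm φ lam (Rh (f1 t)) χ := fun t χ hχ => by
    have h := hRh (f1 t) (hf1 t) χ hχ
    rw [aForm_sub_left hlam_pos (hS _ (hRhS _)) (hf1 t) (hS χ hχ)] at h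
    linarith
  have hf2P : ∀ t, ∀ χ ∈ S, ⟪f2 t, χ⟫ = ⟪Ph (f2 t), χ⟫ := fun t χ hχ => by
    have h := hPh (f2 t) χ hχ
    rw [inner_sub_left] at h
    linarith
  have hRint : ∀ i, IntervalIntegrable (fun t => ⟪Rh (f1 t), e i⟫) volume 0 T := fun i => by
    have h : ∀ t, ⟪Rh (f1 t), e i⟫ = (μ i)⁻¹ * aForm φ lam (f1 t) (e i) := fun t => by
      rw [hf1R t _ (heS i), aForm_comm, heig i _ (hRhS _), real_inner_comm,
        inv_mul_cancel_left₀ (hμ i).ne']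
    simp only [h]
    exact (intervalIntegrable_aForm_left hlam_pos hf1m hf1 hf1int (hS _ (heS i))).const_mul _
  have hPint : ∀ i, IntervalIntegrable (fun t => ⟪Ph (f2 t), e i⟫) volume 0 T := fun i => by
    simp only [← fun t => hf2P t _ (heS i)]
    exact ⟨hf2int.1.inner_const _, hf2int.2.inner_const _⟩
  have hzero : ∀ i, IntervalIntegrable (fun _ => ⟪(0 : H), e i⟫) volume 0 T := fun i => by simp
  set g : ℝ → EuclideanSpace ℝ (Fin m ⊕ Fin m) :=
    fun t => modeMap e μ l (Rh (f1 t), Ph (f2 t)) with hg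
  have hgint : IntervalIntegrable g volume 0 T := intervalIntegrable_modeMap e μ l hRint hPint
  have hgsub : ∀ k < N, IntervalIntegrable g volume (tt k) (tt (k + 1)) := fun k hk => by
    refine hgint.mono_set ?_
    rw [Set.uIcc_of_le (httlt k hk).le, Set.uIcc_of_le hT.le]
    exact Set.Icc_subset_Icc (htt0 ▸ hmono 0 k (by omega) hk.le) (httN ▸ hmono (k + 1) N hk le_rfl)
  have hpval : ∀ {c : ℕ → ℕ → H}, (∀ n j, c n j ∈ S) → ∀ n s, pval q c n s ∈ S :=
    fun hc n s => S.sum_mem fun j _ => S.smul_mem _ (hc n j)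
  have hpderiv : ∀ {c : ℕ → ℕ → H}, (∀ n j, c n j ∈ S) → ∀ n s, pderiv q c n s ∈ S :=
    fun hc n s => S.sum_mem fun j _ => S.smul_mem _ (hc n j)
  have hnode : ∀ k, nodeVal q tt c1 uh0 k ∈ S := fun k => by
    unfold nodeVal
    split_ifs
    exacts [huh0, hpval hc1 k _]
  set x : ℕ → EuclideanSpace ℝ (Fin m ⊕ Fin m) :=
    fun k => modeMap e μ l (nodeVal q tt c1 uh0 k, nodeVal q tt c2 vh0 k) with hx
  have hpair := fun {u : H} (hu : u ∈ S) (v : H) (y) =>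
    aForm_testFst_add_inner_testSnd hlam_pos hμ hS heS heig hu v l y
  have hskew := fun {u v : H} (hu : u ∈ S) (hv : v ∈ S) (y) =>
    aForm_testFst_sub_aForm_testSnd hlam_pos hμ hS heS heig hu hv l y
  have hstep : ∀ k < N, ‖x (k + 1)‖
      ≤ ‖x k‖ + stepConst q * ∫ s in tt k..tt (k + 1), ‖g s‖ := by
    intro k hk
    set c : ℕ → EuclideanSpace ℝ (Fin m ⊕ Fin m) :=
      fun j => modeMap e μ l (c1 (k + 1) j, c2 (k + 1) j) with hc
    have hcval : ∀ s, polyVal q c s = modeMap e μ l (pval q c1 (k + 1) s, pval q c2 (k + 1) s) := by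
      intro s
      rw [hc, ← map_polyVal (modeMap e μ l) q fun j => (c1 (k + 1) j, c2 (k + 1) j)]
      congr 1
      ext <;> simp [polyVal, pval, Prod.fst_sum, Prod.snd_sum]
    have hcderiv : ∀ s, polyDeriv q c s
        = modeMap e μ l (pderiv q c1 (k + 1) s, pderiv q c2 (k + 1) s) := by
      intro s
      rw [hc, ← map_polyDeriv (modeMap e μ l) q fun j => (c1 (k + 1) j, c2 (k + 1) j)]
      congr 1
      ext <;> simp [polyDeriv, pderiv, Prod.fst_sum, Prod.snd_sum]
    have hxc : x (k + 1) = polyVal q c (tt (k + 1)) := by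
      rw [hcval]
      simp [hx, nodeVal]
    rw [hxc]
    refine norm_polyVal_right_le_of_dG q (httlt k hk) (waveGen μ) (inner_waveGen_self μ) c (x k)
      (hgsub k hk) fun d => ?_
    have h := dG_local_eq hlam_pos hS huh0 hc1 heq hk
      (w1 := fun j => testFst e μ l (d j)) (w2 := fun j => testSnd e μ l (d j))
      (fun j => testFst_mem heS l _) (fun j => testSnd_mem heS l _)
    simp only [← map_polyVal] at h
    rw [hpair (S.sub_mem (hpval hc1 _ _) (hnode k))] at h
    simp only [fun s => hf1R s _ (testFst_mem (μ := μ) heS l (polyVal q d s)),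
      fun s => hf2P s _ (testSnd_mem (μ := μ) heS l (polyVal q d s)),
      fun s => hpair (hRhS (f1 s)) (Ph (f2 s)) (polyVal q d s)] at h
    have hsub : polyVal q c (tt k) - x k = modeMap e μ l
        (pval q c1 (k + 1) (tt k) - nodeVal q tt c1 uh0 k,
          pval q c2 (k + 1) (tt k) - nodeVal q tt c2 vh0 k) := by
      rw [hcval, hx, ← map_sub]
      rfl
    rw [hsub, ← h]
    congr 2
    ext s
    rw [hcderiv, hcval, ← hpair (hpderiv hc1 _ _), ← hskew (hpval hc1 _ _) (hpval hc2 _ _)]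
    ring
  have htel : ∀ k ≤ N, ‖x k‖ ≤ ‖x 0‖
      + stepConst q * ∑ j ∈ Finset.range k, ∫ s in tt j..tt (j + 1), ‖g s‖ := by
    intro k
    induction k with
    | zero => simp
    | succ k ih =>
      intro hk
      rw [Finset.sum_range_succ]
      linarith [hstep k hk, ih (by omega)]
  have hxN := htel N le_rfl
  rw [intervalIntegral.sum_integral_adjacent_intervals fun k hk => (hgsub k hk).norm, htt0,
    httN] at hxN
  have hx0 : ‖x 0‖ ≤ hNormh e μ (l + 1) uh0 + hNormh e μ l vh0 := by
    simpa [hx, nodeVal] using norm_modeMap_le hμ l uh0 vh0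
  have hgle : ∫ t in (0 : ℝ)..T, ‖g t‖ ≤ ∫ t in (0 : ℝ)..T,
      (hNormh e μ (l + 1) (Rh (f1 t)) + hNormh e μ l (Ph (f2 t))) := by
    refine intervalIntegral.integral_mono_on hT.le hgint.norm ?_ fun t _ => norm_modeMap_le hμ l _ _
    simp only [← norm_modeMap_fst hμ, ← norm_modeMap_snd hμ]
    exact (intervalIntegrable_modeMap e μ l hRint hzero).norm.add
      (intervalIntegrable_modeMap e μ l hzero hPint).norm
  have hend := hNormh_add_hNormh_le (e := e) hμ l (pval q c1 N (tt N)) (pval q c2 N (tt N))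
  have hxN' : x N = modeMap e μ l (pval q c1 N (tt N), pval q c2 N (tt N)) := by
    simp [hx, nodeVal, show N ≠ 0 by omega]
  rw [← hxN'] at hend
  have hC := stepConst_nonneg q
  have hgle' := mul_le_mul_of_nonneg_left hgle hC
  have hgnn : 0 ≤ ∫ t in (0 : ℝ)..T, ‖g t‖ :=
    intervalIntegral.integral_nonneg hT.le fun t _ => norm_nonneg _
  have hdata := mul_nonneg hC ((norm_nonneg _).trans hx0)
  linarith
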